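/- Let t be a λ-term that is strongly normalizing for the combined reduction by β, δ, γ and assoc, and let F(t) be the term obtained from t by choosing a subterm u occurring at some node on the left (head) branch of t and replacing u by (λx.(u x)) for a variable x not free in u. Then F(t) is strongly normalizing. -/

import Mathlib

/-- Untyped λ-terms in de Bruijn representation. -/
inductive Lam : Type
  | var : ℕ → Lam
  | lam : Lam → Lam
  | app : Lam → Lam → Lam

namespace Lam

/-- Renaming of de Bruijn indices (extended under binders). -/
def rename (f : ℕ → ℕ) : Lam → Lam
  | var n => var (f n)
  | lam b => lam (rename (fun n => match n with | 0 => 0 | m+1 => f m + 1) b)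
  | app a b => app (rename f a) (rename f b)

/-- Shift all free indices up by one. -/
def shift : Lam → Lam := rename Nat.succ

/-- Swap the two innermost free indices. -/
def swap01 : Lam → Lam := rename (fun n => match n with | 0 => 1 | 1 => 0 | m => m)

/-- Capture-avoiding substitution of `u` for the free variable (index) `k`. -/
def subst : Lam → ℕ → Lam → Lam
  | var n, k, u => if n = k then u else if k < n then var (n-1) else var n
  | lam b, k, u => lam (subst b (k+1) (shift u))
  | app a b, k, u => app (subst a k u) (subst b k u)

/-- The names of the four reduction rules. -/
inductive Rule | beta | delta | gamma | assoc

/-- One-step reduction by a given rule, closed under all term contexts.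
β : (λx.M) N ▷ M[x:=N]
δ : (λy.λx.M) N ▷ λx.((λy.M) N)   (x ∉ FV N)
γ : ((λx.M) N) P ▷ (λx.(M P)) N   (x ∉ FV P)
assoc : M ((λx.N) P) ▷ (λx.(M N)) P   (x ∉ FV M) -/
inductive StepR : Rule → Lam → Lam → Prop
  | beta (M N) : StepR .beta (app (lam M) N) (subst M 0 N)
  | delta (M N) : StepR .delta (app (lam (lam M)) N) (lam (app (lam (swap01 M)) (shift N)))
  | gamma (M N P) : StepR .gamma (app (app (lam M) N) P) (app (lam (app M (shift P))) N)
  | assoc (M N P) : StepR .assoc (app M (app (lam N) P)) (app (lam (app (shift M) N)) P)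
  | appL {r M M'} (N) : StepR r M M' → StepR r (app M N) (app M' N)
  | appR {r N N'} (M) : StepR r N N' → StepR r (app M N) (app M N')
  | under {r M M'} : StepR r M M' → StepR r (lam M) (lam M')

/-- One-step reduction by any of β, δ, γ, assoc. -/
def Step (t t' : Lam) : Prop := ∃ r, StepR r t t'

/-- One-step β-reduction alone. -/
def StepBeta : Lam → Lam → Prop := StepR Rule.beta

/-- `t` is strongly normalizing for the reduction relation `R`:
every `R`-reduction sequence from `t` is finite. -/
def SN (R : Lam → Lam → Prop) (t : Lam) : Prop := Acc (fun a b => R b a) t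

/-- Left-nested application `(H M₁ … Mₙ)`. -/
def apps : Lam → List Lam → Lam
  | H, [] => H
  | H, M :: Ms => apps (app H M) Ms

/-- Types of system 𝒟 : atoms, arrow and intersection. -/
inductive Ty : Type
  | atom : ℕ → Ty
  | arrow : Ty → Ty → Ty
  | inter : Ty → Ty → Ty

/-- Typing judgment of system 𝒟 (contexts are lists of types, de Bruijn style). -/
inductive Typed : List Ty → Lam → Ty → Prop
  | var {Γ n A} : Γ[n]? = some A → Typed Γ (var n) A
  | app {Γ M N A B} : Typed Γ M (.arrow A B) → Typed Γ N A → Typed Γ (app M N) B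
  | lam {Γ M A B} : Typed (A :: Γ) M B → Typed Γ (lam M) (.arrow A B)
  | interI {Γ M A B} : Typed Γ M A → Typed Γ M B → Typed Γ M (.inter A B)
  | interE1 {Γ M A B} : Typed Γ M (.inter A B) → Typed Γ M A
  | interE2 {Γ M A B} : Typed Γ M (.inter A B) → Typed Γ M B

/-- A term is typable in system 𝒟 if it has a type in some context. -/
def Typable (t : Lam) : Prop := ∃ Γ A, Typed Γ t A

end Lam

namespace Lam

/-- `LeftEtaExp t t'` : `t'` is obtained from `t` by choosing the subterm `u` at
some node of the left (head) branch of `t` and replacing it by `λx.(u x)` with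
`x` not free in `u` (de Bruijn: `λ.((shift u) 0)`). -/
inductive LeftEtaExp : Lam → Lam → Prop
  | here (u : Lam) : LeftEtaExp u (lam (app (shift u) (var 0)))
  | left {a a'} (b : Lam) : LeftEtaExp a a' → LeftEtaExp (app a b) (app a' b)

end Lam

namespace Lam

open Relation

/-! ### Parallel substitution -/

/-- Extension of a renaming under one binder. -/
def liftRen (f : ℕ → ℕ) : ℕ → ℕ
  | 0 => 0
  | m + 1 => f m + 1

theorem rename_lam (f : ℕ → ℕ) (b : Lam) :
    rename f (lam b) = lam (rename (liftRen f) b) := by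
  simp only [rename]
  congr 2

/-- Extension of a parallel substitution under one binder. -/
def up (σ : ℕ → Lam) : ℕ → Lam
  | 0 => var 0
  | n + 1 => shift (σ n)

/-- Parallel substitution. -/
def sub : (ℕ → Lam) → Lam → Lam
  | σ, var n => σ n
  | σ, lam b => lam (sub (up σ) b)
  | σ, app a b => app (sub σ a) (sub σ b)

theorem rename_eq_sub (f : ℕ → ℕ) (t : Lam) : rename f t = sub (fun n => var (f n)) t := by
  induction t generalizing f with
  | var n => rfl
  | lam b ih =>
    rw [rename_lam, ih, sub]
    congr 2
    funext n
    cases n <;> rfl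
  | app a b iha ihb => simp [rename, sub, iha, ihb]

theorem sub_rename (σ : ℕ → Lam) (f : ℕ → ℕ) (t : Lam) :
    sub σ (rename f t) = sub (fun n => σ (f n)) t := by
  induction t generalizing σ f with
  | var n => rfl
  | lam b ih =>
    rw [rename_lam, sub, ih, sub]
    congr 2
    funext n
    cases n <;> rfl
  | app a b iha ihb => simp [rename, sub, iha, ihb]

theorem rename_rename (g f : ℕ → ℕ) (t : Lam) :
    rename g (rename f t) = rename (fun n => g (f n)) t := by
  rw [rename_eq_sub g, sub_rename, rename_eq_sub]

theorem rename_sub (f : ℕ → ℕ) (σ : ℕ → Lam) (t : Lam) :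
    rename f (sub σ t) = sub (fun n => rename f (σ n)) t := by
  induction t generalizing σ f with
  | var n => rfl
  | lam b ih =>
    rw [sub, rename_lam, ih, sub]
    congr 2
    funext n
    cases n with
    | zero => rfl
    | succ n => simp [up, shift, rename_rename, liftRen]
  | app a b iha ihb => simp [rename, sub, iha, ihb]

theorem sub_up_shift (σ : ℕ → Lam) (t : Lam) : sub (up σ) (shift t) = shift (sub σ t) := by
  rw [shift, sub_rename, rename_sub]
  rfl

theorem sub_sub (τ σ : ℕ → Lam) (t : Lam) :
    sub τ (sub σ t) = sub (fun n => sub τ (σ n)) t := by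
  induction t generalizing σ τ with
  | var n => rfl
  | lam b ih =>
    rw [sub, sub, ih, sub]
    congr 2
    funext n
    cases n with
    | zero => rfl
    | succ n => exact sub_up_shift τ (σ n)
  | app a b iha ihb => simp [sub, iha, ihb]

theorem sub_var (t : Lam) : sub var t = t := by
  induction t with
  | var n => rfl
  | lam b ih =>
    have : up var = var := by
      funext n
      cases n <;> rfl
    rw [sub, this, ih]
  | app a b iha ihb => simp [sub, iha, ihb]

/-- The parallel substitution replacing index `k` by `u` and lowering the larger indices. -/
def inst (k : ℕ) (u : Lam) (n : ℕ) : Lam :=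
  if n = k then u else if k < n then var (n - 1) else var n

theorem up_inst (k : ℕ) (u : Lam) : up (inst k u) = inst (k + 1) (shift u) := by
  funext n
  cases n with
  | zero => simp [up, inst]
  | succ n =>
    simp only [up, inst, Nat.add_right_cancel_iff, Nat.add_lt_add_iff_right]
    split_ifs with h₁ h₂
    · rfl
    · simp only [shift, rename]
      congr 1
      omega
    · rfl

theorem subst_eq_sub (t : Lam) (k : ℕ) (u : Lam) : subst t k u = sub (inst k u) t := by
  induction t generalizing k u with
  | var n => rfl
  | lam b ih => rw [subst, sub, ih, up_inst]
  | app a b iha ihb => simp [subst, sub, iha, ihb]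

theorem sub_subst_zero (σ : ℕ → Lam) (M N : Lam) :
    sub σ (subst M 0 N) = subst (sub (up σ) M) 0 (sub σ N) := by
  rw [subst_eq_sub, subst_eq_sub, sub_sub, sub_sub]
  congr 1
  funext n
  cases n with
  | zero => rfl
  | succ n =>
    rw [up, shift, sub_rename]
    exact (sub_var _).symm

theorem subst_shift (M N : Lam) : subst (shift M) 0 N = M := by
  rw [subst_eq_sub, shift, sub_rename]
  exact sub_var M

theorem sub_swap01 (σ : ℕ → Lam) (M : Lam) :
    sub (up (up σ)) (swap01 M) = swap01 (sub (up (up σ)) M) := by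
  rw [swap01, sub_rename, rename_sub]
  congr 1
  funext n
  match n with
  | 0 => rfl
  | 1 => rfl
  | n + 2 =>
    simp only [up, shift, rename_rename]

theorem subst_swap01_shift (M N : Lam) :
    subst (swap01 M) 0 (shift N) = subst M 1 (shift N) := by
  rw [subst_eq_sub, subst_eq_sub, swap01, sub_rename]
  congr 1
  funext n
  match n with
  | 0 => rfl
  | 1 => rfl
  | n + 2 => simp [inst]

theorem StepR.sub {r : Rule} {t t' : Lam} (h : StepR r t t') (σ : ℕ → Lam) :
    StepR r (Lam.sub σ t) (Lam.sub σ t') := by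
  induction h generalizing σ with
  | beta M N =>
    rw [sub_subst_zero]
    exact .beta _ _
  | delta M N =>
    simp only [Lam.sub, sub_swap01, sub_up_shift]
    exact .delta _ _
  | gamma M N P =>
    simp only [Lam.sub, sub_up_shift]
    exact .gamma _ _ _
  | assoc M N P =>
    simp only [Lam.sub, sub_up_shift]
    exact .assoc _ _ _
  | appL N _ ih => exact .appL _ (ih σ)
  | appR M _ ih => exact .appR _ (ih σ)
  | under _ ih => exact .under (ih _)

theorem StepR.subst_left {r : Rule} {M M' : Lam} (h : StepR r M M') (N : Lam) :
    StepR r (subst M 0 N) (subst M' 0 N) := by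
  rw [subst_eq_sub, subst_eq_sub]
  exact h.sub _

theorem steps_app {r : Rule} {a a' b b' : Lam} (ha : ReflTransGen (StepR r) a a')
    (hb : ReflTransGen (StepR r) b b') : ReflTransGen (StepR r) (app a b) (app a' b') :=
  (ha.lift (fun x => app x b) fun _ _ h => h.appL b).trans
    (hb.lift (fun x => app a' x) fun _ _ h => h.appR a')

theorem steps_sub {r : Rule} {σ τ : ℕ → Lam} (h : ∀ n, ReflTransGen (StepR r) (σ n) (τ n))
    (t : Lam) : ReflTransGen (StepR r) (sub σ t) (sub τ t) := by
  induction t generalizing σ τ with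
  | var n => exact h n
  | lam b ih =>
    refine (ih (σ := up σ) (τ := up τ) fun n => ?_).lift lam fun _ _ h => StepR.under h
    cases n with
    | zero => exact .refl
    | succ n =>
      refine (h n).lift shift fun x y hxy => ?_
      simp only [Function.onFun, shift, rename_eq_sub]
      exact hxy.sub _
  | app a b iha ihb => exact steps_app (iha h) (ihb h)

theorem StepR.subst_right {r : Rule} {N N' : Lam} (h : StepR r N N') (M : Lam) :
    ReflTransGen (StepR r) (subst M 0 N) (subst M 0 N') := by
  rw [subst_eq_sub, subst_eq_sub]
  refine steps_sub (fun n => ?_) M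
  cases n with
  | zero => exact .single h
  | succ n => exact .refl

/-! ### Termination of the permutation rules -/

/-- Number of abstractions. -/
def lams : Lam → ℕ
  | var _ => 0
  | lam b => lams b + 1
  | app a b => lams a + lams b

/-- Sum over all applications of a height, which starts at `h`, grows when entering either side
of an application and decreases when entering an abstraction. -/
def heightSum : Lam → ℕ → ℕ
  | var _, _ => 0
  | lam b, h => heightSum b (h - 1)
  | app a b, h => h + heightSum a (h + 1) + heightSum b (h + 1)

theorem lams_rename (f : ℕ → ℕ) (t : Lam) : lams (rename f t) = lams t := by
  induction t generalizing f with
  | var n => rfl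
  | lam b ih => rw [rename_lam, lams, ih, lams]
  | app a b iha ihb => simp [rename, lams, iha, ihb]

theorem heightSum_rename (f : ℕ → ℕ) (t : Lam) (h : ℕ) :
    heightSum (rename f t) h = heightSum t h := by
  induction t generalizing f h with
  | var n => rfl
  | lam b ih => rw [rename_lam, heightSum, ih, heightSum]
  | app a b iha ihb => simp [rename, heightSum, iha, ihb]

theorem heightSum_mono (t : Lam) {h h' : ℕ} (hh : h ≤ h') : heightSum t h ≤ heightSum t h' := by
  induction t generalizing h h' with
  | var n => exact le_rfl
  | lam b ih => exact ih (by omega)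
  | app a b iha ihb =>
    have := @iha (h + 1) (h' + 1) (by omega)
    have := @ihb (h + 1) (h' + 1) (by omega)
    simp only [heightSum]
    omega

theorem StepR.lams_eq {r : Rule} {t t' : Lam} (h : StepR r t t') (hr : r ≠ .beta) :
    lams t' = lams t := by
  induction h with
  | beta => exact absurd rfl hr
  | delta | gamma | assoc =>
    simp only [lams, swap01, shift, lams_rename]
    omega
  | appL _ _ ih | appR _ _ ih | under _ ih => simp [lams, ih hr]

theorem StepR.heightSum_lt {r : Rule} {t t' : Lam} (hs : StepR r t t') (hr : r ≠ .beta) {h : ℕ}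
    (hh : lams t ≤ h) : heightSum t' h < heightSum t h := by
  induction hs generalizing h with
  | beta => exact absurd rfl hr
  | delta M N =>
    simp only [lams] at hh
    obtain ⟨k, rfl⟩ : ∃ k, h = k + 2 := ⟨h - 2, by omega⟩
    have := heightSum_mono N (h := k + 2) (h' := k + 3) (by omega)
    simp only [heightSum, swap01, shift, heightSum_rename, Nat.add_one_sub_one,
      show k + 2 - 1 = k + 1 by omega, show k + 1 + 1 = k + 2 by omega,
      show k + 2 + 1 = k + 3 by omega] at *
    omega
  | gamma M N P =>
    have := heightSum_mono N (h := h + 1) (h' := h + 1 + 1) (by omega)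
    simp only [heightSum, shift, heightSum_rename, Nat.add_sub_cancel]
    omega
  | assoc M N P =>
    have := heightSum_mono P (h := h + 1) (h' := h + 1 + 1) (by omega)
    simp only [heightSum, shift, heightSum_rename, Nat.add_sub_cancel]
    omega
  | appL N _ ih =>
    simp only [lams] at hh
    have := @ih hr (h + 1) (by omega)
    simp only [heightSum]
    omega
  | appR N _ ih =>
    simp only [lams] at hh
    have := @ih hr (h + 1) (by omega)
    simp only [heightSum]
    omega
  | under _ ih =>
    simp only [lams] at hh
    exact ih hr (by omega)

/-! ### Head reduction -/

/-- `HeadBeta t N s`: contracting the head redex of `t`, whose argument is `N`, gives `s`. -/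
inductive HeadBeta : Lam → Lam → Lam → Prop
  | redex (M N) : HeadBeta (app (lam M) N) N (subst M 0 N)
  | appL {a N c} (b) : HeadBeta a N c → HeadBeta (app a b) N (app c b)

/-- A variable applied to some arguments. -/
inductive Neutral : Lam → Prop
  | var (n) : Neutral (var n)
  | app {a} (b) : Neutral a → Neutral (app a b)

theorem HeadBeta.unique {t N s N' s' : Lam} (h : HeadBeta t N s) (h' : HeadBeta t N' s') :
    N = N' ∧ s = s' := by
  induction h generalizing N' s' with
  | redex M N =>
    cases h' with
    | redex => exact ⟨rfl, rfl⟩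
    | appL _ h' => cases h'
  | appL b h ih =>
    cases h' with
    | redex => cases h
    | appL _ h' =>
      obtain ⟨rfl, rfl⟩ := ih h'
      exact ⟨rfl, rfl⟩

theorem HeadBeta.not_neutral {t N s : Lam} (h : HeadBeta t N s) : ¬ Neutral t := by
  induction h with
  | redex M N => exact fun hn => by cases hn with | app _ hn => cases hn
  | appL b _ ih => exact fun hn => by cases hn with | app _ hn => exact ih hn

theorem HeadBeta.stepR {t N s : Lam} (h : HeadBeta t N s) : StepR .beta t s := by
  induction h with
  | redex M N => exact .beta M N
  | appL b _ ih => exact .appL b ih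

theorem HeadBeta.sub {t N s : Lam} (h : HeadBeta t N s) (σ : ℕ → Lam) :
    HeadBeta (Lam.sub σ t) (Lam.sub σ N) (Lam.sub σ s) := by
  induction h with
  | redex M N =>
    rw [sub_subst_zero]
    exact .redex _ _
  | appL b _ ih => exact .appL _ ih

theorem HeadBeta.rename {t N s : Lam} (h : HeadBeta t N s) (f : ℕ → ℕ) :
    HeadBeta (Lam.rename f t) (Lam.rename f N) (Lam.rename f s) := by
  simp only [rename_eq_sub]
  exact h.sub _

theorem Neutral.rename {t : Lam} (h : Neutral t) (f : ℕ → ℕ) : Neutral (Lam.rename f t) := by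
  induction h with
  | var n => exact .var _
  | app b _ ih => exact .app _ ih

theorem neutral_or_headBeta (a b : Lam) : Neutral (app a b) ∨ ∃ N s, HeadBeta (app a b) N s := by
  induction a generalizing b with
  | var n => exact .inl (.app b (.var n))
  | lam M => exact .inr ⟨b, _, .redex M b⟩
  | app a c iha _ =>
    obtain h | ⟨N, s, h⟩ := iha c
    · exact .inl (.app b h)
    · exact .inr ⟨N, _, .appL b h⟩

/-- The ways in which a step `t ▷ u` by rule `r` can interact with the head redex of `t`, whose
argument is `N` and whose contraction gives `s`. -/
inductive HeadInteraction (r : Rule) (N s u : Lam) : Prop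
  | contract : r = .beta → u = s → HeadInteraction r N s u
  | same : r ≠ .beta → HeadBeta u N s → HeadInteraction r N s u
  | outside {s'} : HeadBeta u N s' → StepR r s s' → HeadInteraction r N s u
  | argument {N' s'} : HeadBeta u N' s' → StepR r N N' → ReflTransGen (StepR r) s s' →
      HeadInteraction r N s u
  | exchange {s₁ P v w} : r ≠ .beta → ReflTransGen (StepR r) s s₁ → HeadBeta s₁ P v →
      HeadBeta u P w → HeadBeta w N v → HeadInteraction r N s u
  | nested {P K v w} : r ≠ .beta → HeadBeta N P K → ReflTransGen (StepR .beta) s v →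
      HeadBeta u P w → HeadBeta w K v → HeadInteraction r N s u
  | abstraction {v w} : r ≠ .beta → s = lam v → u = lam w → HeadBeta w (shift N) v →
      HeadInteraction r N s u

theorem HeadInteraction.appL {r : Rule} {N s u : Lam} (h : HeadInteraction r N s u) (b : Lam) :
    HeadInteraction r N (app s b) (app u b) := by
  cases h with
  | contract hr h => exact .contract hr (by rw [h])
  | same hr h => exact .same hr (h.appL b)
  | outside h hs => exact .outside (h.appL b) (hs.appL b)
  | argument h hN hs => exact .argument (h.appL b) hN (steps_app hs .refl)
  | exchange hr hs h₁ h₂ h₃ =>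
    exact .exchange hr (steps_app hs .refl) (h₁.appL b) (h₂.appL b) (h₃.appL b)
  | nested hr hN hs h₁ h₂ =>
    exact .nested hr hN (steps_app hs .refl) (h₁.appL b) (h₂.appL b)
  | abstraction hr hs hu h =>
    subst hs hu
    refine .exchange hr .refl (.redex _ b) (.redex _ b) ?_
    have := h.sub (inst 0 b)
    simp only [← subst_eq_sub, subst_shift] at this
    exact this

theorem HeadBeta.interaction {t N s : Lam} (h : HeadBeta t N s) {r : Rule} {u : Lam}
    (hs : StepR r t u) : HeadInteraction r N s u := by
  induction h generalizing u with
  | redex M N =>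
    cases hs with
    | beta => exact .contract rfl rfl
    | delta M N =>
      refine .abstraction (by simp) rfl rfl ?_
      rw [← subst_swap01_shift]
      exact .redex _ _
    | assoc _ K P =>
      refine .nested (by simp) (.redex K P) ((StepR.beta K P).subst_right M) (.redex _ P) ?_
      rw [subst, subst_shift]
      exact .redex M _
    | appL _ hs =>
      cases hs with
      | under hs => exact .outside (.redex _ N) (hs.subst_left N)
    | appR _ hs => exact .argument (.redex M _) hs (hs.subst_right M)
  | @appL a N a' b h ih =>
    cases hs with
    | beta => cases h
    | delta => cases h
    | gamma M =>
      cases h with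
      | redex =>
        refine .same (by simp) ?_
        have := HeadBeta.redex (app M (shift b)) N
        rwa [subst, subst_shift] at this
      | appL _ h => cases h
    | assoc _ K P =>
      refine .exchange (by simp) (.single (.assoc _ K P)) (.redex _ P) (.redex _ P) ?_
      simp only [subst, subst_shift]
      exact h.appL _
    | appL _ hs => exact (ih hs).appL b
    | appR _ hs => exact .outside (h.appL _) (hs.appR _)

/-! ### A bound on the length of reductions -/

/-- `Bound t n`: the term `t` is strongly normalizing for β, and `n` bounds the number of β-steps
from `t`, the arguments of erasing redexes being reduced as well. -/
inductive Bound : Lam → ℕ → Prop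
  | var (x) : Bound (var x) 0
  | lam {b n} : Bound b n → Bound (Lam.lam b) n
  | neutral {a b n m} : Neutral a → Bound a n → Bound b m → Bound (app a b) (n + m)
  | head {t N s n m} : HeadBeta t N s → Bound s n → Bound N m → Bound t (n + m + 1)

theorem Bound.rename {t : Lam} {n : ℕ} (h : Bound t n) (f : ℕ → ℕ) :
    Bound (Lam.rename f t) n := by
  induction h generalizing f with
  | var x => exact .var _
  | lam _ ih =>
    rw [rename_lam]
    exact .lam (ih _)
  | neutral ha _ _ iha ihb => exact .neutral (ha.rename f) (iha f) (ihb f)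
  | head h _ _ ihs ihN => exact .head (h.rename f) (ihs f) (ihN f)

theorem Bound.of_lam {b : Lam} {n : ℕ} (h : Bound (Lam.lam b) n) : Bound b n := by
  cases h with
  | lam h => exact h
  | head h => cases h

theorem Bound.of_headBeta {t N s : Lam} {k : ℕ} (h : Bound t k) (hh : HeadBeta t N s) :
    ∃ n m, k = n + m + 1 ∧ Bound s n ∧ Bound N m := by
  cases h with
  | var => cases hh
  | lam => cases hh
  | neutral ha => exact absurd (ha.app _) hh.not_neutral
  | head hh' hs hN =>
    obtain ⟨rfl, rfl⟩ := hh.unique hh'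
    exact ⟨_, _, rfl, hs, hN⟩

theorem Bound.of_neutral {a b : Lam} {k : ℕ} (h : Bound (app a b) k) (ha : Neutral a) :
    ∃ n m, k = n + m ∧ Bound a n ∧ Bound b m := by
  cases h with
  | neutral _ hn hm => exact ⟨_, _, rfl, hn, hm⟩
  | head hh => exact absurd (ha.app b) hh.not_neutral

theorem Bound.app_var {t : Lam} {n : ℕ} (h : Bound t n) (x : ℕ) :
    ∃ m, Bound (app t (Lam.var x)) m := by
  induction h with
  | var y => exact ⟨_, .neutral (.var y) (.var y) (.var x)⟩
  | @lam b n h _ =>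
    refine ⟨n + 0 + 1, .head (.redex _ _) ?_ (.var x)⟩
    rw [subst_eq_sub]
    have : inst 0 (Lam.var x) = fun k => Lam.var (if k = 0 then x else k - 1) := by
      funext k
      cases k <;> rfl
    rw [this, ← rename_eq_sub]
    exact h.rename _
  | neutral ha hn hm => exact ⟨_, .neutral (ha.app _) (.neutral ha hn hm) (.var x)⟩
  | head hh _ hN ihs _ =>
    obtain ⟨m, hm⟩ := ihs
    exact ⟨_, .head (hh.appL _) hm hN⟩

/-- The least decrease of the bound under a step by the given rule. -/
def Rule.cost : Rule → ℕ
  | .beta => 1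
  | _ => 0

theorem Rule.cost_eq_zero {r : Rule} (h : r ≠ .beta) : r.cost = 0 := by
  cases r <;> first | rfl | exact absurd rfl h

theorem Rule.cost_le_one (r : Rule) : r.cost ≤ 1 := by
  cases r <;> simp [cost]

/-- Every step from a term with bound `n` decreases the bound by at least the cost of its rule. -/
def Decreasing (n : ℕ) : Prop :=
  ∀ ⦃t t' : Lam⦄ ⦃r : Rule⦄, Bound t n → StepR r t t' → ∃ n', n' + r.cost ≤ n ∧ Bound t' n'

theorem Bound.steps {r : Rule} {t t' : Lam} {n k : ℕ} (ih : ∀ m < k, Decreasing m) (hn : n < k)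
    (h : Bound t n) (hs : ReflTransGen (StepR r) t t') : ∃ n' ≤ n, Bound t' n' := by
  induction hs with
  | refl => exact ⟨n, le_rfl, h⟩
  | tail _ hs ih' =>
    obtain ⟨m, hm, hb⟩ := ih'
    obtain ⟨m', hm', hb'⟩ := ih m (by omega) hb hs
    exact ⟨m', by omega, hb'⟩

theorem Bound.head_step {t N s u : Lam} {r : Rule} {k : ℕ} (ih : ∀ m < k, Decreasing m)
    (h : Bound t k) (hh : HeadBeta t N s) (hs : StepR r t u) :
    ∃ n', n' + r.cost ≤ k ∧ Bound u n' := by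
  obtain ⟨n, m, rfl, hn, hm⟩ := h.of_headBeta hh
  cases hh.interaction hs with
  | contract _ hu =>
    subst hu
    have := r.cost_le_one
    exact ⟨n, by omega, hn⟩
  | same hr hu => exact ⟨_, by rw [Rule.cost_eq_zero hr], .head hu hn hm⟩
  | outside hu hs =>
    obtain ⟨n', hle, hn'⟩ := ih n (by omega) hn hs
    exact ⟨_, by omega, .head hu hn' hm⟩
  | argument hu hN hs =>
    obtain ⟨m', hle, hm'⟩ := ih m (by omega) hm hN
    obtain ⟨n', hle', hn'⟩ := hn.steps ih (by omega) hs
    exact ⟨_, by omega, .head hu hn' hm'⟩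
  | exchange hr hs h₁ h₂ h₃ =>
    obtain ⟨n', hle, hn'⟩ := hn.steps ih (by omega) hs
    obtain ⟨v, p, rfl, hv, hp⟩ := hn'.of_headBeta h₁
    exact ⟨_, by rw [Rule.cost_eq_zero hr]; omega, .head h₂ (.head h₃ hv hm) hp⟩
  | nested hr hN hs h₁ h₂ =>
    obtain ⟨n', hle, hn'⟩ := hn.steps ih (by omega) hs
    obtain ⟨q, p, rfl, hq, hp⟩ := hm.of_headBeta hN
    exact ⟨_, by rw [Rule.cost_eq_zero hr]; omega, .head h₁ (.head h₂ hn' hq) hp⟩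
  | abstraction hr hs hu hw =>
    subst hs hu
    exact ⟨_, by rw [Rule.cost_eq_zero hr], .lam (.head hw hn.of_lam (hm.rename _))⟩

/-- A step from a neutral term either gives a neutral term, or moves an abstraction of an argument
to the head. -/
theorem Bound.neutral_step {a a' : Lam} {r : Rule} {n : ℕ} (ha : Neutral a) (h : Bound a n)
    (hs : StepR r a a')
    (ih : ∀ {b b' m}, sizeOf b < sizeOf a → m ≤ n → Bound b m → StepR r b b' →
      ∃ m', m' + r.cost ≤ m ∧ Bound b' m') :
    (Neutral a' ∧ ∃ n', n' + r.cost ≤ n ∧ Bound a' n') ∨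
      (r ≠ .beta ∧ ∃ P s p k, HeadBeta a' P s ∧ Neutral s ∧ Bound P p ∧ Bound s k ∧
        k + p + 1 ≤ n) := by
  induction ha generalizing a' n with
  | var x => cases hs
  | @app a b ha iha =>
    obtain ⟨n, m, rfl, hn, hm⟩ := h.of_neutral ha
    cases hs with
    | beta => cases ha
    | delta => cases ha
    | gamma => cases ha with | app _ ha => cases ha
    | assoc _ K P =>
      obtain ⟨k, p, rfl, hk, hp⟩ := hm.of_headBeta (.redex K P)
      refine .inr ⟨by simp, P, app a (subst K 0 P), p, n + k, ?_, ha.app _, hp,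
        .neutral ha hn hk, by omega⟩
      have := HeadBeta.redex (app (shift a) K) P
      rwa [subst, subst_shift] at this
    | appL _ hs =>
      obtain ⟨ha', n', hle, hn'⟩ | ⟨hr, P, s, p, k, hh, hns, hp, hk, hle⟩ :=
        iha hn hs fun hlt hle => ih (by simp only [app.sizeOf_spec]; omega) (by omega)
      · exact .inl ⟨ha'.app b, n' + m, by omega, .neutral ha' hn' hm⟩
      · exact .inr ⟨hr, P, _, p, k + m, hh.appL b, hns.app b, hp, .neutral hns hk hm, by omega⟩
    | appR _ hs =>
      obtain ⟨m', hle, hm'⟩ := ih (by simp only [app.sizeOf_spec]; omega) (by omega) hm hs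
      exact .inl ⟨ha.app _, n + m', by omega, .neutral ha hn hm'⟩

theorem Bound.step {t t' : Lam} {r : Rule} {n : ℕ} (h : Bound t n) (hs : StepR r t t') :
    ∃ n', n' + r.cost ≤ n ∧ Bound t' n' := by
  revert t t' r
  change Decreasing n
  induction n using Nat.strong_induction_on with
  | _ n ih =>
  suffices ∀ (k : ℕ) (t t' : Lam) (r : Rule) (n' : ℕ), sizeOf t ≤ k → n' ≤ n → Bound t n' →
      StepR r t t' → ∃ m, m + r.cost ≤ n' ∧ Bound t' m from
    fun t t' r h hs => this _ t t' r n le_rfl le_rfl h hs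
  intro k
  induction k with
  | zero => intro t t' r n' hk; cases t <;> simp at hk
  | succ k ihk =>
    intro t t' r n' hk hn h hs
    cases t with
    | var x => cases hs
    | lam b =>
      cases hs with
      | under hs =>
        simp only [lam.sizeOf_spec] at hk
        obtain ⟨m, hm, hb⟩ := ihk _ _ _ _ (by omega) hn h.of_lam hs
        exact ⟨m, hm, hb.lam⟩
    | app a b =>
      obtain hneu | ⟨N, s, hh⟩ := neutral_or_headBeta a b
      · obtain ⟨-, hres⟩ | ⟨hr, P, s, p, q, hh, -, hp, hq, hle⟩ :=
          h.neutral_step hneu hs fun hlt hle => ihk _ _ _ _ (by omega) (by omega)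
        · exact hres
        · exact ⟨_, by rw [Rule.cost_eq_zero hr]; omega, .head hh hq hp⟩
      · exact h.head_step (fun m hm => ih m (by omega)) hh hs

theorem Bound.sn {t : Lam} {n : ℕ} (h : Bound t n) : SN Step t := by
  induction n using Nat.strong_induction_on generalizing t with
  | _ n ih =>
  induction hk : heightSum t (lams t) using Nat.strong_induction_on generalizing t with
  | _ k ihk =>
  subst hk
  refine ⟨_, fun t' ⟨r, hs⟩ => ?_⟩
  obtain ⟨n', hle, h'⟩ := h.step hs
  by_cases hr : r = .beta
  · subst hr
    exact ih n' (by simp only [Rule.cost] at hle; omega) h'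
  · obtain hlt | rfl : n' < n ∨ n' = n := by omega
    · exact ih n' hlt h'
    · refine ihk _ ?_ h' rfl
      rw [hs.lams_eq hr]
      exact hs.heightSum_lt hr le_rfl

/-! ### Strongly normalizing terms are bounded -/

/-- `ReductOrSub a b`: `a` is a reduct or an immediate subterm of `b`. -/
inductive ReductOrSub : Lam → Lam → Prop
  | step {a b} : Step b a → ReductOrSub a b
  | lam (b) : ReductOrSub b (lam b)
  | fn (a b) : ReductOrSub a (app a b)
  | arg (a b) : ReductOrSub b (app a b)

theorem SN.acc_reductOrSub {t : Lam} (h : SN Step t) : Acc ReductOrSub t := by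
  induction h with
  | intro t hacc ih =>
  clear hacc
  induction t with
  | var x => exact ⟨_, fun _ h => by cases h with | step h => exact ih _ h⟩
  | lam b ihb =>
    have hb := ihb fun b' ⟨r, h⟩ => (ih _ ⟨r, h.under⟩).inv (.lam b')
    exact ⟨_, fun _ h => by
      cases h with
      | step h => exact ih _ h
      | lam => exact hb⟩
  | app a b iha ihb =>
    have ha := iha fun a' ⟨r, h⟩ => (ih _ ⟨r, h.appL b⟩).inv (.fn a' b)
    have hb := ihb fun b' ⟨r, h⟩ => (ih _ ⟨r, h.appR a⟩).inv (.arg a b')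
    exact ⟨_, fun _ h => by
      cases h with
      | step h => exact ih _ h
      | fn => exact ha
      | arg => exact hb⟩

theorem HeadBeta.transGen_reductOrSub {t N s : Lam} (h : HeadBeta t N s) :
    TransGen ReductOrSub N t := by
  induction h with
  | redex M N => exact .single (.arg _ N)
  | appL b _ ih => exact ih.tail (.fn _ b)

theorem SN.exists_bound {t : Lam} (h : SN Step t) : ∃ n, Bound t n := by
  have hacc := h.acc_reductOrSub.transGen
  clear h
  induction hacc with
  | intro t _ ih =>
  cases t with
  | var x => exact ⟨0, .var x⟩
  | lam b =>
    obtain ⟨n, hn⟩ := ih b (.single (.lam b))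
    exact ⟨n, hn.lam⟩
  | app a b =>
    obtain hneu | ⟨N, s, hh⟩ := neutral_or_headBeta a b
    · cases hneu with
      | app _ ha =>
        obtain ⟨n, hn⟩ := ih a (.single (.fn a b))
        obtain ⟨m, hm⟩ := ih b (.single (.arg a b))
        exact ⟨_, .neutral ha hn hm⟩
    · obtain ⟨n, hn⟩ := ih s (.single (.step ⟨_, hh.stepR⟩))
      obtain ⟨m, hm⟩ := ih N hh.transGen_reductOrSub
      exact ⟨_, .head hh hn hm⟩

theorem SN.of_app_left {a b : Lam} (h : SN Step (app a b)) : SN Step a :=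
  Subrelation.accessible (fun ⟨r, hs⟩ => ⟨r, hs.appL b⟩)
    (InvImage.accessible (fun x => app x b) h)

theorem SN.of_app_right {a b : Lam} (h : SN Step (app a b)) : SN Step b :=
  Subrelation.accessible (fun ⟨r, hs⟩ => ⟨r, hs.appR a⟩)
    (InvImage.accessible (fun x => app a x) h)

theorem LeftEtaExp.headBeta_app {a a' : Lam} (h : LeftEtaExp a a') (b : Lam)
    (hsn : SN Step (app a b)) : ∃ N, HeadBeta (app a' b) N (app a b) ∧ SN Step N := by
  induction h generalizing b with
  | here u =>
    refine ⟨b, ?_, hsn.of_app_right⟩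
    have := HeadBeta.redex (app (shift u) (var 0)) b
    rwa [subst, subst_shift] at this
  | left c _ ih =>
    obtain ⟨N, hh, hN⟩ := ih c hsn.of_app_left
    exact ⟨N, hh.appL b, hN⟩

end Lam

open Lam in
/-- If `t` is strongly normalizing for the combined reduction by
β, δ, γ, assoc and `F t` is obtained from `t` by replacing a subterm `u` on the
left branch of `t` by `λx.(u x)`, then `F t` is strongly normalizing. -/
theorem sn_left_eta_expansion (t Ft : Lam) (h : SN Step t) (hF : LeftEtaExp t Ft) :
    SN Step Ft := by
  obtain ⟨n, hn⟩ := h.exists_bound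
  cases hF with
  | here =>
    obtain ⟨m, hm⟩ := (hn.rename Nat.succ).app_var 0
    exact hm.lam.sn
  | left b hF =>
    obtain ⟨N, hh, hN⟩ := hF.headBeta_app b h
    obtain ⟨m, hm⟩ := hN.exists_bound
    exact (Bound.head hh hn hm).sn
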